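/- Let G = (N, Act, R) be a first-order grammar, n ∈ ℕ, and g : ℕ_+ → ℕ_+ a nondecreasing function. Then there exists ℓ ∈ ℕ such that every eqlevel-decreasing (n,g)-sequence of pairs of regular terms over N (with respect to L^act_G) has length at most ℓ. -/

import Mathlib

/-- The "signature" of a first-order grammar: a finite set of ranked nonterminals
(represented as `Fin ntCount`, with arities) and a finite set of actions
(represented as `Fin actCount`). -/
structure GrammarSig where
  ntCount : ℕ
  arity : Fin ntCount → ℕ
  actCount : ℕ

/-- The polynomial functor whose coinductive fixed point is the set of (finite or
infinite) terms over the nonterminals: a node is labelled either by a nonterminal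
`A` (with `arity A` ordered children) or by a variable `x_n`, `n : ℕ` (a leaf). -/
def GrammarSig.P (S : GrammarSig) : PFunctor :=
  ⟨Fin S.ntCount ⊕ ℕ, fun l =>
    match l with
    | Sum.inl A => Fin (S.arity A)
    | Sum.inr _ => Empty⟩

/-- Terms over the signature `S`: finite or infinite ordered trees with nodes labelled
by nonterminals (inner nodes) or variables (leaves). -/
def GTerm (S : GrammarSig) := PFunctor.M S.P

/-- The term consisting of the single variable `x_n`. -/
def GTerm.var (S : GrammarSig) (n : ℕ) : GTerm S :=
  PFunctor.M.mk ⟨Sum.inr n, fun e => e.elim⟩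

/-- The term `A(c 0, …, c (m-1))`. -/
def GTerm.app {S : GrammarSig} (A : Fin S.ntCount) (c : Fin (S.arity A) → GTerm S) :
    GTerm S :=
  PFunctor.M.mk ⟨Sum.inl A, c⟩

/-- Applying a substitution `σ` to a term `T`: every occurrence of a variable `x_n`
in `T` is replaced by `σ n` (defined corecursively). -/
def GTerm.subst {S : GrammarSig} (σ : ℕ → GTerm S) (T : GTerm S) : GTerm S :=
  PFunctor.M.corec
    (fun st : Bool × GTerm S =>
      match PFunctor.M.dest st.2 with
      | ⟨Sum.inl A, c⟩ => ⟨Sum.inl A, fun i => (st.1, c i)⟩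
      | ⟨Sum.inr n, _⟩ =>
        if st.1 then
          ⟨(PFunctor.M.dest (σ n)).1, fun i => (false, (PFunctor.M.dest (σ n)).2 i)⟩
        else ⟨Sum.inr n, fun e => e.elim⟩)
    (true, T)

/-- A substitution (as a total map `ℕ → GTerm S`) has finite support. -/
def FinSupp {S : GrammarSig} (σ : ℕ → GTerm S) : Prop :=
  {n | σ n ≠ GTerm.var S n}.Finite

/-- `childRel S T T'`: `T'` is a root-successor (depth-1 subterm occurrence) of `T`. -/
def childRel (S : GrammarSig) : GTerm S → GTerm S → Prop := fun T T' =>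
  ∃ (A : Fin S.ntCount) (c : Fin (S.arity A) → GTerm S), T = GTerm.app A c ∧ ∃ i, T' = c i

/-- `T'` is a subterm of `T`. -/
def SubtermOf (S : GrammarSig) (T' T : GTerm S) : Prop :=
  Relation.ReflTransGen (childRel S) T T'

/-- The variable `x_n` occurs in `T`. -/
def VarOccurs (S : GrammarSig) (n : ℕ) (T : GTerm S) : Prop :=
  SubtermOf S (GTerm.var S n) T

/-- `OccAtDepth S d T V`: `V` has a subterm-occurrence in `T` at depth `d`. -/
inductive OccAtDepth (S : GrammarSig) : ℕ → GTerm S → GTerm S → Prop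
  | refl (T : GTerm S) : OccAtDepth S 0 T T
  | step {d : ℕ} {T T' V : GTerm S} :
      childRel S T T' → OccAtDepth S d T' V → OccAtDepth S (d + 1) T V

/-- A term is regular if it has only finitely many distinct subterms. -/
def RegularT (S : GrammarSig) (T : GTerm S) : Prop := {T' | SubtermOf S T' T}.Finite

/-- The presentation size of a (regular) term: the number of its distinct subterms. -/
noncomputable def pressize (S : GrammarSig) (T : GTerm S) : ℕ :=
  {T' | SubtermOf S T' T}.ncard

/-- Finite terms over the signature `S`. -/
inductive FTerm (S : GrammarSig) where
  | var : ℕ → FTerm S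
  | app : (A : Fin S.ntCount) → (Fin (S.arity A) → FTerm S) → FTerm S

/-- The (finite or infinite) term corresponding to a finite term. -/
def FTerm.toTerm {S : GrammarSig} : FTerm S → GTerm S
  | .var n => GTerm.var S n
  | .app A c => GTerm.app A (fun i => (c i).toTerm)

/-- The variable `x_n` occurs in the finite term `E`. -/
def FTerm.VOccurs {S : GrammarSig} (n : ℕ) : FTerm S → Prop
  | .var m => m = n
  | .app _ c => ∃ i, (c i).VOccurs n

/-- The depth of a finite term (the largest depth of a subterm occurrence). -/
def FTerm.depth {S : GrammarSig} : FTerm S → ℕ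
  | .var _ => 0
  | .app _ c => Finset.univ.sup fun i => (c i).depth + 1

/-- A rule `A(x_0, …, x_{m−1}) →ₐ E` of a first-order grammar: `E` is a finite term
all of whose variables are among `x_0, …, x_{m−1}` where `m = arity A`. -/
structure GRule (S : GrammarSig) where
  nt : Fin S.ntCount
  act : Fin S.actCount
  rhs : FTerm S
  rhs_wf : ∀ n : ℕ, rhs.VOccurs n → n < S.arity nt

/-- A first-order grammar: a signature together with a finite set (list) of rules. -/
structure FOGrammar where
  sig : GrammarSig
  rules : List (GRule sig)

/-- The term `A(x_0, …, x_{m−1})` (the left-hand side of rules for `A`). -/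
def lhsTerm {S : GrammarSig} (A : Fin S.ntCount) : GTerm S :=
  GTerm.app A fun i => GTerm.var S i.val

/-- A labelled transition system with states `S` and actions `A`. -/
structure LTS (S : Type*) (A : Type*) where
  Tr : A → S → S → Prop

namespace LTS

variable {S A : Type*}

/-- An LTS is image-finite if each state has finitely many `a`-successors. -/
def ImageFinite (L : LTS S A) : Prop := ∀ a s, {t | L.Tr a s t}.Finite

/-- A set `B` of pairs of states covers the pair `p`. -/
def Covers (L : LTS S A) (B : Set (S × S)) (p : S × S) : Prop :=
  (∀ a s', L.Tr a p.1 s' → ∃ t', L.Tr a p.2 t' ∧ (s', t') ∈ B) ∧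
  (∀ a t', L.Tr a p.2 t' → ∃ s', L.Tr a p.1 s' ∧ (s', t') ∈ B)

/-- `B'` covers the set `B` (i.e., covers each of its pairs). -/
def CoversSet (L : LTS S A) (B' B : Set (S × S)) : Prop := ∀ p ∈ B, L.Covers B' p

/-- `B ⊐ B'`: `B'` is a minimal expansion for `B`. -/
def MinExp (L : LTS S A) (B B' : Set (S × S)) : Prop :=
  L.CoversSet B' B ∧ ∀ B'', B'' ⊂ B' → ¬ L.CoversSet B'' B

/-- The stratified equivalences: `∼_0` is everything, `∼_{k+1}` are the pairs covered by `∼_k`. -/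
def simN (L : LTS S A) : ℕ → Set (S × S)
  | 0 => Set.univ
  | k + 1 => {p | L.Covers (L.simN k) p}

/-- `eqlevel(s,t) ∈ ℕ ∪ {ω}`: the largest `e` with `s ∼_e t` (`⊤` plays the role of `ω`,
meaning `s ∼_k t` for all `k ∈ ℕ`). -/
noncomputable def eqlevel (L : LTS S A) (s t : S) : ℕ∞ :=
  sSup {e : ℕ∞ | ∃ k : ℕ, e = (k : ℕ∞) ∧ (s, t) ∈ L.simN k}

/-- `LeastEqLev(B) = min {eqlevel(s,t) | (s,t) ∈ B}`, with `min ∅ = ω = ⊤`. -/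
noncomputable def leastEqLev (L : LTS S A) (B : Set (S × S)) : ℕ∞ :=
  sInf {e : ℕ∞ | ∃ p ∈ B, e = L.eqlevel p.1 p.2}

/-- `B` is a bisimulation if it covers itself. -/
def Bisimulation (L : LTS S A) (B : Set (S × S)) : Prop := L.CoversSet B B

/-- `s ∼ t`: some bisimulation contains `(s,t)`. -/
def Bisim (L : LTS S A) (s t : S) : Prop := ∃ B, L.Bisimulation B ∧ (s, t) ∈ B

end LTS

/-- The rule-based LTS `L^rul_G`: states are the terms, actions are the rules of `G`,
and a rule `r : A(x_0,…,x_{m−1}) →ₐ E` induces `(A(x_0,…,x_{m−1}))σ →r Eσ` for every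
substitution `σ`. -/
def LTSrul (G : FOGrammar) : LTS (GTerm G.sig) (GRule G.sig) where
  Tr r T T' := r ∈ G.rules ∧ ∃ σ : ℕ → GTerm G.sig, FinSupp σ ∧
    T = GTerm.subst σ (lhsTerm r.nt) ∧ T' = GTerm.subst σ r.rhs.toTerm

/-- The action-based LTS `L^act_G`: the transitions of `L^rul_G` relabelled by the
actions of the rules; in addition each variable `x_n` has its own fresh action
(represented by `Sum.inr n`) with the single transition `x_n →_{a_{x_n}} x_n`. -/
def LTSact (G : FOGrammar) : LTS (GTerm G.sig) (Fin G.sig.actCount ⊕ ℕ) where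
  Tr a T T' :=
    match a with
    | Sum.inl a => ∃ r : GRule G.sig, r.act = a ∧ (LTSrul G).Tr r T T'
    | Sum.inr n => T = GTerm.var G.sig n ∧ T' = GTerm.var G.sig n

/-- `RPath G T w T'`: the path `T →w T'` in the rule-based LTS `L^rul_G`, `w ∈ R*`. -/
inductive RPath (G : FOGrammar) : GTerm G.sig → List (GRule G.sig) → GTerm G.sig → Prop
  | nil (T : GTerm G.sig) : RPath G T [] T
  | cons {T T1 T' : GTerm G.sig} {r : GRule G.sig} {w : List (GRule G.sig)} :
      (LTSrul G).Tr r T T1 → RPath G T1 w T' → RPath G T (r :: w) T'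

/-- `APath G T w T'`: the path `T →w T'` in the action-based LTS `L^act_G` for a word
`w ∈ Act*` of proper actions (using no special variable transitions). -/
inductive APath (G : FOGrammar) :
    GTerm G.sig → List (Fin G.sig.actCount) → GTerm G.sig → Prop
  | nil (T : GTerm G.sig) : APath G T [] T
  | cons {T T1 T' : GTerm G.sig} {a : Fin G.sig.actCount} {w : List (Fin G.sig.actCount)} :
      (LTSact G).Tr (Sum.inl a) T T1 → APath G T1 w T' → APath G T (a :: w) T'

namespace GTerm

variable {S : GrammarSig}

/-- The root label of a term together with its root-successors. -/
def out (T : GTerm S) : S.P (GTerm S) := PFunctor.M.dest T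

/-- The term generated corecursively by `f` from a seed. -/
def gen {α : Type} (f : α → S.P α) (a : α) : GTerm S := PFunctor.M.corec f a

theorem out_gen {α : Type} (f : α → S.P α) (a : α) : out (gen f a) = S.P.map (gen f) (f a) :=
  PFunctor.M.dest_corec f a

theorem out_app (A : Fin S.ntCount) (c : Fin (S.arity A) → GTerm S) :
    out (app A c) = ⟨Sum.inl A, c⟩ :=
  PFunctor.M.dest_mk _

theorem out_var (n : ℕ) : out (var S n) = ⟨Sum.inr n, fun e => e.elim⟩ :=
  PFunctor.M.dest_mk _

theorem out_injective : Function.Injective (out (S := S)) := by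
  intro T U h
  exact ((PFunctor.M.mk_dest T).symm.trans (congrArg PFunctor.M.mk h)).trans
    (PFunctor.M.mk_dest U)

theorem var_or_app (T : GTerm S) :
    (∃ n, T = var S n) ∨ ∃ (A : Fin S.ntCount) (c : Fin (S.arity A) → GTerm S), T = app A c := by
  obtain ⟨l, f, h⟩ : ∃ l f, out T = ⟨l, f⟩ := ⟨_, _, rfl⟩
  cases l with
  | inl A => exact Or.inr ⟨A, f, out_injective (h.trans (out_app A f).symm)⟩
  | inr n =>
    refine Or.inl ⟨n, out_injective (h.trans (Eq.trans ?_ (out_var n).symm))⟩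
    exact Sigma.ext rfl (heq_of_eq (funext fun e => e.elim))

theorem var_injective : Function.Injective (var S) := by
  intro m n h
  have h' := congrArg out h
  rw [out_var, out_var] at h'
  exact Sum.inr.inj (Sigma.mk.inj h').1

theorem app_ne_var (A : Fin S.ntCount) (c : Fin (S.arity A) → GTerm S) (n : ℕ) :
    app A c ≠ var S n := by
  intro h
  have h' := congrArg out h
  rw [out_var, out_app] at h'
  exact Sum.inl_ne_inr (Sigma.mk.inj h').1

theorem app_inj {A B : Fin S.ntCount} {c : Fin (S.arity A) → GTerm S}
    {d : Fin (S.arity B) → GTerm S} (h : app A c = app B d) : A = B ∧ c ≍ d := by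
  have h' := congrArg out h
  rw [out_app, out_app] at h'
  obtain ⟨h1, h2⟩ := Sigma.mk.inj h'
  exact ⟨Sum.inl.inj h1, h2⟩

/-- The corecursion step defining `GTerm.subst`; the flag tells whether variables are still to
be replaced. -/
def substStep (σ : ℕ → GTerm S) (st : Bool × GTerm S) : S.P (Bool × GTerm S) :=
  match out st.2 with
  | ⟨Sum.inl A, c⟩ => ⟨Sum.inl A, fun i => (st.1, c i)⟩
  | ⟨Sum.inr n, _⟩ =>
    if st.1 then ⟨(out (σ n)).1, fun i => (false, (out (σ n)).2 i)⟩
    else ⟨Sum.inr n, fun e => e.elim⟩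

theorem subst_eq_gen (σ : ℕ → GTerm S) (T : GTerm S) :
    subst σ T = gen (substStep σ) (true, T) := rfl

theorem substStep_app (σ : ℕ → GTerm S) (b : Bool) (A : Fin S.ntCount)
    (c : Fin (S.arity A) → GTerm S) :
    substStep σ (b, app A c) = ⟨Sum.inl A, fun i => (b, c i)⟩ := by
  simp only [substStep, out_app]
  rfl

theorem substStep_true_var (σ : ℕ → GTerm S) (n : ℕ) :
    substStep σ (true, var S n) = ⟨(out (σ n)).1, fun i => (false, (out (σ n)).2 i)⟩ := by
  simp only [substStep, out_var]
  rfl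

theorem substStep_false (σ : ℕ → GTerm S) (T : GTerm S) :
    substStep σ (false, T) = ⟨(out T).1, fun i => (false, (out T).2 i)⟩ := by
  obtain ⟨m, rfl⟩ | ⟨A, c, rfl⟩ := var_or_app T
  · simp only [substStep, out_var]
    exact Sigma.ext rfl (heq_of_eq (funext fun e => e.elim))
  · rw [substStep_app, out_app]

theorem gen_substStep_false (σ : ℕ → GTerm S) (T : GTerm S) :
    gen (substStep σ) (false, T) = T := by
  refine PFunctor.M.bisim (fun x y => x = gen (substStep σ) (false, y)) ?_ _ _ rfl
  rintro _ y rfl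
  refine ⟨(out y).1, _, (out y).2, ?_, rfl, fun i => rfl⟩
  exact (out_gen _ _).trans (congrArg _ (substStep_false σ y))

theorem subst_app (σ : ℕ → GTerm S) (A : Fin S.ntCount) (c : Fin (S.arity A) → GTerm S) :
    subst σ (app A c) = app A (fun i => subst σ (c i)) := by
  apply out_injective
  rw [out_app, subst_eq_gen, out_gen, substStep_app]
  rfl

theorem subst_var (σ : ℕ → GTerm S) (n : ℕ) : subst σ (var S n) = σ n := by
  apply out_injective
  rw [subst_eq_gen, out_gen, substStep_true_var]
  exact Sigma.ext rfl (heq_of_eq (funext fun i => gen_substStep_false σ _))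

open Classical in
/-- Replaces the variable `x` repeatedly by `H`, i.e. by the limit `H[x := H[x := ⋯]]`. -/
noncomputable def unroll (x : ℕ) (H : GTerm S) : GTerm S → GTerm S :=
  gen fun U => if U = var S x then out H else out U

theorem unroll_app (x : ℕ) (H : GTerm S) (A : Fin S.ntCount) (c : Fin (S.arity A) → GTerm S) :
    unroll x H (app A c) = app A (fun i => unroll x H (c i)) := by
  apply out_injective
  rw [out_app, unroll, out_gen, if_neg (app_ne_var _ _ _), out_app]
  rfl

theorem unroll_var_of_ne {x y : ℕ} (H : GTerm S) (h : y ≠ x) :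
    unroll x H (var S y) = var S y := by
  apply out_injective
  rw [unroll, out_gen, if_neg (fun e => h (var_injective e)), out_var]
  exact Sigma.ext rfl (heq_of_eq (funext fun e => e.elim))

theorem unroll_var_self {x : ℕ} {H : GTerm S} (h : H ≠ var S x) :
    unroll x H (var S x) = unroll x H H := by
  apply out_injective
  rw [unroll, out_gen, out_gen, if_pos rfl, if_neg h]

/-- A map on terms that commutes with the nonterminal constructors. -/
def IsHom (h : GTerm S → GTerm S) : Prop :=
  ∀ (A : Fin S.ntCount) (c : Fin (S.arity A) → GTerm S), h (app A c) = app A (fun i => h (c i))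

theorem isHom_subst (σ : ℕ → GTerm S) : IsHom (subst σ) := subst_app σ

theorem isHom_unroll (x : ℕ) (H : GTerm S) : IsHom (unroll x H) := unroll_app x H

theorem IsHom.comp {h h' : GTerm S → GTerm S} (hh : IsHom h) (hh' : IsHom h') :
    IsHom (fun T => h (h' T)) := fun A c => (congrArg h (hh' A c)).trans (hh A _)

end GTerm

/-- The set `X` is closed under taking root-successors. -/
def ChildClosed {S : GrammarSig} (X : Finset (GTerm S)) : Prop :=
  ∀ T ∈ X, ∀ T', childRel S T T' → T' ∈ X

theorem not_childRel_var {S : GrammarSig} {n : ℕ} {T : GTerm S} :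
    ¬ childRel S (GTerm.var S n) T := by
  rintro ⟨A, c, h, -⟩
  exact GTerm.app_ne_var A c n h.symm

theorem childRel_app {S : GrammarSig} {A : Fin S.ntCount} {c : Fin (S.arity A) → GTerm S}
    {T : GTerm S} : childRel S (GTerm.app A c) T ↔ ∃ i, T = c i := by
  constructor
  · rintro ⟨B, d, h, i, rfl⟩
    obtain ⟨rfl, h'⟩ := GTerm.app_inj h
    exact ⟨i, by rw [eq_of_heq h']⟩
  · rintro ⟨i, rfl⟩
    exact ⟨A, c, rfl, i, rfl⟩

theorem exists_childClosed_of_regularT {S : GrammarSig} {T : GTerm S} (h : RegularT S T) :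
    ∃ X : Finset (GTerm S), ChildClosed X ∧ T ∈ X ∧ X.card = pressize S T := by
  have hfin : {T' | SubtermOf S T' T}.Finite := h
  refine ⟨hfin.toFinset, fun U hU V hV => ?_, hfin.mem_toFinset.2 Relation.ReflTransGen.refl,
    (Set.ncard_eq_toFinset_card _ hfin).symm⟩
  exact hfin.mem_toFinset.2 (Relation.ReflTransGen.tail (hfin.mem_toFinset.1 hU) hV)

open Classical in
theorem ChildClosed.union {S : GrammarSig} {X Y : Finset (GTerm S)} (hX : ChildClosed X)
    (hY : ChildClosed Y) : ChildClosed (X ∪ Y) := by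
  intro T hT T' hT'
  rw [Finset.mem_union] at hT ⊢
  exact hT.imp (fun h => hX T h T' hT') (fun h => hY T h T' hT')

open Classical in
theorem ChildClosed.image_unroll {S : GrammarSig} {X : Finset (GTerm S)} (hX : ChildClosed X)
    {x : ℕ} {H : GTerm S} (hH : H ∈ X) (hne : H ≠ GTerm.var S x) :
    ChildClosed (X.image (GTerm.unroll x H)) := by
  have key : ∀ T ∈ X, T ≠ GTerm.var S x → ∀ T', childRel S (GTerm.unroll x H T) T' →
      T' ∈ X.image (GTerm.unroll x H) := by
    intro T hT hTx T' hT'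
    obtain ⟨n, rfl⟩ | ⟨A, c, rfl⟩ := GTerm.var_or_app T
    · rw [GTerm.unroll_var_of_ne _ (fun e => hTx (by rw [e]))] at hT'
      exact (not_childRel_var hT').elim
    · rw [GTerm.unroll_app, childRel_app] at hT'
      obtain ⟨i, rfl⟩ := hT'
      exact Finset.mem_image_of_mem _ (hX _ hT _ (childRel_app.2 ⟨i, rfl⟩))
  intro U hU T' hT'
  obtain ⟨T, hT, rfl⟩ := Finset.mem_image.1 hU
  by_cases hTx : T = GTerm.var S x
  · rw [hTx, GTerm.unroll_var_self hne] at hT'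
    exact key H hH hne T' hT'
  · exact key T hT hTx T' hT'

namespace FTerm

variable {S : GrammarSig}

/-- The instance of a finite term under an assignment of terms to its variables. -/
def inst (s : ℕ → GTerm S) : FTerm S → GTerm S
  | .var n => s n
  | .app A c => GTerm.app A (fun i => (c i).inst s)

theorem subst_toTerm (s : ℕ → GTerm S) (E : FTerm S) : GTerm.subst s E.toTerm = E.inst s := by
  induction E with
  | var n => exact GTerm.subst_var s n
  | app A c ih => simp only [toTerm, inst, GTerm.subst_app, ih]

theorem inst_congr {s t : ℕ → GTerm S} (E : FTerm S) (h : ∀ n, E.VOccurs n → s n = t n) :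
    E.inst s = E.inst t := by
  induction E with
  | var n => exact h n rfl
  | app A c ih =>
    simp only [inst]
    congr 1
    funext i
    exact ih i fun n hn => h n ⟨i, hn⟩

theorem map_inst {h : GTerm S → GTerm S} (hh : GTerm.IsHom h)
    (s : ℕ → GTerm S) (E : FTerm S) : h (E.inst s) = E.inst (fun n => h (s n)) := by
  induction E with
  | var n => rfl
  | app A c ih => simp only [inst, hh A, ih]

/-- The number of nonterminal nodes of a finite term. -/
def size : FTerm S → ℕ
  | .var _ => 0
  | .app _ c => 1 + ∑ i, (c i).size

open Classical in
/-- The instances of the non-variable subterms of a finite term. -/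
noncomputable def insts (s : ℕ → GTerm S) : FTerm S → Finset (GTerm S)
  | .var _ => ∅
  | .app A c =>
    insert (GTerm.app A (fun i => (c i).inst s)) (Finset.univ.biUnion fun i => (c i).insts s)

theorem card_insts_le (s : ℕ → GTerm S) (E : FTerm S) : (E.insts s).card ≤ E.size := by
  classical
  induction E with
  | var n => simp [insts, size]
  | app A c ih =>
    simp only [insts, size]
    refine (Finset.card_insert_le _ _).trans ?_
    rw [add_comm]
    gcongr
    exact Finset.card_biUnion_le.trans (Finset.sum_le_sum fun i _ => ih i)

open Classical in
theorem inst_mem_union_insts (s : ℕ → GTerm S) {X : Finset (GTerm S)} (E : FTerm S)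
    (h : ∀ n, E.VOccurs n → s n ∈ X) : E.inst s ∈ X ∪ E.insts s := by
  cases E with
  | var n => exact Finset.mem_union_left _ (h n rfl)
  | app A c => exact Finset.mem_union_right _ (Finset.mem_insert_self _ _)

open Classical in
theorem childClosed_union_insts (s : ℕ → GTerm S) {X : Finset (GTerm S)} (hX : ChildClosed X)
    (E : FTerm S) (h : ∀ n, E.VOccurs n → s n ∈ X) : ChildClosed (X ∪ E.insts s) := by
  induction E with
  | var n => simpa [insts] using hX
  | app A c ih =>
    have hsub : ∀ i, X ∪ (c i).insts s ⊆ X ∪ (FTerm.app A c).insts s := by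
      intro i
      refine Finset.union_subset_union_right fun V hV => ?_
      exact Finset.mem_insert_of_mem (Finset.mem_biUnion.2 ⟨i, Finset.mem_univ i, hV⟩)
    intro T hT T' hT'
    obtain hT | hT := Finset.mem_union.1 hT
    · exact Finset.mem_union_left _ (hX T hT T' hT')
    obtain rfl | hT := Finset.mem_insert.1 hT
    · obtain ⟨i, rfl⟩ := childRel_app.1 hT'
      exact hsub i (inst_mem_union_insts s (c i) fun n hn => h n ⟨i, hn⟩)
    · obtain ⟨i, -, hi⟩ := Finset.mem_biUnion.1 hT
      exact hsub i (ih i (fun n hn => h n ⟨i, hn⟩) T (Finset.mem_union_right _ hi) T' hT')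

end FTerm

namespace GRule

variable {S : GrammarSig}

/-- The assignment of the arguments `c` to the variables `x_0, …, x_{m−1}`. -/
def assign {m : ℕ} (c : Fin m → GTerm S) (n : ℕ) : GTerm S :=
  if h : n < m then c ⟨n, h⟩ else GTerm.var S n

theorem assign_of_lt {m : ℕ} (c : Fin m → GTerm S) {n : ℕ} (h : n < m) :
    assign c n = c ⟨n, h⟩ := dif_pos h

/-- The result of applying a rule to a term with root-successors `c`. -/
def result (r : GRule S) (c : Fin (S.arity r.nt) → GTerm S) : GTerm S :=
  r.rhs.inst (assign c)

theorem map_result (r : GRule S) {h : GTerm S → GTerm S} (hh : GTerm.IsHom h)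
    (c : Fin (S.arity r.nt) → GTerm S) : h (r.result c) = r.result (fun i => h (c i)) := by
  unfold result
  rw [FTerm.map_inst hh]
  refine FTerm.inst_congr _ fun n hn => ?_
  rw [assign_of_lt _ (r.rhs_wf n hn), assign_of_lt _ (r.rhs_wf n hn)]

end GRule

section Transitions

variable {G : FOGrammar}

theorem LTSrul_tr_iff {r : GRule G.sig} {T T' : GTerm G.sig} :
    (LTSrul G).Tr r T T' ↔ r ∈ G.rules ∧ ∃ c, T = GTerm.app r.nt c ∧ T' = r.result c := by
  constructor
  · rintro ⟨hr, σ, -, rfl, rfl⟩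
    refine ⟨hr, fun i => σ i, ?_, ?_⟩
    · simp only [lhsTerm, GTerm.subst_app, GTerm.subst_var]
    · rw [FTerm.subst_toTerm]
      refine FTerm.inst_congr _ fun n hn => ?_
      rw [GRule.assign_of_lt _ (r.rhs_wf n hn)]
  · rintro ⟨hr, c, rfl, rfl⟩
    refine ⟨hr, GRule.assign c, ?_, ?_, ?_⟩
    · refine (Set.finite_lt_nat (G.sig.arity r.nt)).subset fun n hn => ?_
      by_contra hlt
      exact hn (dif_neg hlt)
    · simp only [lhsTerm, GTerm.subst_app, GTerm.subst_var]
      congr 1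
      funext i
      rw [GRule.assign_of_lt _ i.isLt]
    · rw [FTerm.subst_toTerm]
      rfl

theorem LTSact_tr_inl_iff {a : Fin G.sig.actCount} {T T' : GTerm G.sig} :
    (LTSact G).Tr (Sum.inl a) T T' ↔
      ∃ r ∈ G.rules, r.act = a ∧ ∃ c, T = GTerm.app r.nt c ∧ T' = r.result c := by
  constructor
  · rintro ⟨r, ha, h⟩
    obtain ⟨hr, h⟩ := LTSrul_tr_iff.1 h
    exact ⟨r, hr, ha, h⟩
  · rintro ⟨r, hr, ha, h⟩
    exact ⟨r, ha, LTSrul_tr_iff.2 ⟨hr, h⟩⟩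

theorem LTSact_tr_app {a : Fin G.sig.actCount ⊕ ℕ} {A : Fin G.sig.ntCount}
    {c : Fin (G.sig.arity A) → GTerm G.sig} {T : GTerm G.sig}
    (h : (LTSact G).Tr a (GTerm.app A c) T) :
    ∃ r ∈ G.rules, a = Sum.inl r.act ∧ ∃ c', GTerm.app A c = GTerm.app r.nt c' ∧
      T = r.result c' := by
  cases a with
  | inl a =>
    obtain ⟨r, hr, rfl, c', h⟩ := LTSact_tr_inl_iff.1 h
    exact ⟨r, hr, rfl, c', h⟩
  | inr m => exact (GTerm.app_ne_var _ _ _ h.1).elim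

theorem LTSact_tr_rule {r : GRule G.sig} (hr : r ∈ G.rules)
    (c : Fin (G.sig.arity r.nt) → GTerm G.sig) :
    (LTSact G).Tr (Sum.inl r.act) (GTerm.app r.nt c) (r.result c) :=
  LTSact_tr_inl_iff.2 ⟨r, hr, rfl, c, rfl, rfl⟩

theorem GTerm.IsHom.tr_map {h : GTerm G.sig → GTerm G.sig} (hh : GTerm.IsHom h)
    {a : Fin G.sig.actCount ⊕ ℕ} {A : Fin G.sig.ntCount}
    {c : Fin (G.sig.arity A) → GTerm G.sig} {T : GTerm G.sig}
    (ht : (LTSact G).Tr a (GTerm.app A c) T) : (LTSact G).Tr a (h (GTerm.app A c)) (h T) := by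
  obtain ⟨r, hr, rfl, c', hc, rfl⟩ := LTSact_tr_app ht
  rw [hc, hh, r.map_result hh]
  exact LTSact_tr_rule hr _

theorem GTerm.IsHom.exists_of_tr_map {h : GTerm G.sig → GTerm G.sig} (hh : GTerm.IsHom h)
    {a : Fin G.sig.actCount ⊕ ℕ} {A : Fin G.sig.ntCount}
    {c : Fin (G.sig.arity A) → GTerm G.sig} {U : GTerm G.sig}
    (ht : (LTSact G).Tr a (h (GTerm.app A c)) U) :
    ∃ T, (LTSact G).Tr a (GTerm.app A c) T ∧ U = h T := by
  rw [hh] at ht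
  obtain ⟨r, hr, rfl, c', hc, rfl⟩ := LTSact_tr_app ht
  obtain ⟨rfl, hc⟩ := GTerm.app_inj hc
  rw [← eq_of_heq hc]
  exact ⟨_, LTSact_tr_rule hr c, (r.map_result hh c).symm⟩

end Transitions

namespace LTS

variable {S A : Type*} {L : LTS S A}

theorem Covers.mono {B B' : Set (S × S)} (h : B ⊆ B') {p : S × S} (hp : L.Covers B p) :
    L.Covers B' p :=
  ⟨fun a s' hs => let ⟨t', ht, hB⟩ := hp.1 a s' hs; ⟨t', ht, h hB⟩,
    fun a t' ht => let ⟨s', hs, hB⟩ := hp.2 a t' ht; ⟨s', hs, h hB⟩⟩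

theorem simN_succ_subset (k : ℕ) : L.simN (k + 1) ⊆ L.simN k := by
  induction k with
  | zero => exact Set.subset_univ _
  | succ k ih => exact fun p hp => Covers.mono ih hp

theorem simN_antitone : Antitone L.simN := antitone_nat_of_succ_le simN_succ_subset

theorem simN_refl (k : ℕ) (s : S) : (s, s) ∈ L.simN k := by
  induction k generalizing s with
  | zero => trivial
  | succ k ih => exact ⟨fun a s' h => ⟨s', h, ih s'⟩, fun a s' h => ⟨s', h, ih s'⟩⟩

theorem simN_symm {k : ℕ} {s t : S} (h : (s, t) ∈ L.simN k) : (t, s) ∈ L.simN k := by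
  induction k generalizing s t with
  | zero => trivial
  | succ k ih =>
    exact ⟨fun a t' ht => let ⟨s', hs, hB⟩ := h.2 a t' ht; ⟨s', hs, ih hB⟩,
      fun a s' hs => let ⟨t', ht, hB⟩ := h.1 a s' hs; ⟨t', ht, ih hB⟩⟩

theorem simN_trans {k : ℕ} {s t u : S} (h : (s, t) ∈ L.simN k) (h' : (t, u) ∈ L.simN k) :
    (s, u) ∈ L.simN k := by
  induction k generalizing s t u with
  | zero => trivial
  | succ k ih =>
    refine ⟨fun a s' hs => ?_, fun a u' hu => ?_⟩
    · obtain ⟨t', ht, h1⟩ := h.1 a s' hs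
      obtain ⟨u', hu, h2⟩ := h'.1 a t' ht
      exact ⟨u', hu, ih h1 h2⟩
    · obtain ⟨t', ht, h2⟩ := h'.2 a u' hu
      obtain ⟨s', hs, h1⟩ := h.2 a t' ht
      exact ⟨s', hs, ih h1 h2⟩

theorem le_eqlevel_iff {k : ℕ} {s t : S} : (k : ℕ∞) ≤ L.eqlevel s t ↔ (s, t) ∈ L.simN k := by
  constructor
  · intro h
    cases k with
    | zero => trivial
    | succ k =>
      have hlt : (k : ℕ∞) < L.eqlevel s t :=
        lt_of_lt_of_le (by exact_mod_cast Nat.lt_succ_self k) h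
      obtain ⟨_, ⟨m, rfl, hm⟩, hkm⟩ := lt_sSup_iff.1 hlt
      exact simN_antitone (Nat.succ_le_of_lt (by exact_mod_cast hkm)) hm
  · exact fun h => le_sSup ⟨k, rfl, h⟩

theorem eqlevel_eq_coe_iff {k : ℕ} {s t : S} :
    L.eqlevel s t = k ↔ (s, t) ∈ L.simN k ∧ (s, t) ∉ L.simN (k + 1) := by
  rw [← le_eqlevel_iff, ← le_eqlevel_iff, not_le]
  push_cast
  rw [ENat.lt_natCast_add_one_iff]
  exact ⟨fun h => ⟨h.ge, h.le⟩, fun h => le_antisymm h.2 h.1⟩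

end LTS

section Congruence

variable {G : FOGrammar}

theorem covers_map_app {h h' : GTerm G.sig → GTerm G.sig} (hh : GTerm.IsHom h)
    (hh' : GTerm.IsHom h') {B : Set (GTerm G.sig × GTerm G.sig)} (hB : ∀ T, (h T, h' T) ∈ B)
    (A : Fin G.sig.ntCount) (c : Fin (G.sig.arity A) → GTerm G.sig) :
    (LTSact G).Covers B (h (GTerm.app A c), h' (GTerm.app A c)) := by
  refine ⟨fun a s' hs => ?_, fun a t' ht => ?_⟩
  · obtain ⟨T, hT, rfl⟩ := hh.exists_of_tr_map hs
    exact ⟨h' T, hh'.tr_map hT, hB T⟩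
  · obtain ⟨T, hT, rfl⟩ := hh'.exists_of_tr_map ht
    exact ⟨h T, hh.tr_map hT, hB T⟩

theorem eq_var_of_simN_succ {k n : ℕ} {T : GTerm G.sig}
    (h : (GTerm.var G.sig n, T) ∈ (LTSact G).simN (k + 1)) : T = GTerm.var G.sig n := by
  obtain ⟨t', ht, -⟩ := h.1 (Sum.inr n) _ ⟨rfl, rfl⟩
  exact ht.1

theorem simN_subst (σ : ℕ → GTerm G.sig) {k : ℕ} {T U : GTerm G.sig}
    (h : (T, U) ∈ (LTSact G).simN k) :
    (GTerm.subst σ T, GTerm.subst σ U) ∈ (LTSact G).simN k := by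
  induction k generalizing T U with
  | zero => trivial
  | succ k ih =>
    obtain ⟨n, rfl⟩ | ⟨A, c, rfl⟩ := GTerm.var_or_app T
    · rw [eq_var_of_simN_succ h]
      exact LTS.simN_refl _ _
    obtain ⟨n, rfl⟩ | ⟨B, d, rfl⟩ := GTerm.var_or_app U
    · exact (GTerm.app_ne_var A c n (eq_var_of_simN_succ (LTS.simN_symm h))).elim
    refine ⟨fun a s' hs => ?_, fun a t' ht => ?_⟩
    · obtain ⟨T', hT, rfl⟩ := (GTerm.isHom_subst σ).exists_of_tr_map hs
      obtain ⟨U', hU, hk⟩ := h.1 a T' hT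
      exact ⟨_, (GTerm.isHom_subst σ).tr_map hU, ih hk⟩
    · obtain ⟨U', hU, rfl⟩ := (GTerm.isHom_subst σ).exists_of_tr_map ht
      obtain ⟨T', hT, hk⟩ := h.2 a U' hU
      exact ⟨_, (GTerm.isHom_subst σ).tr_map hT, ih hk⟩

theorem simN_unroll {σ : ℕ → GTerm G.sig} {x : ℕ} {H : GTerm G.sig}
    (hne : H ≠ GTerm.var G.sig x) {m : ℕ}
    (hm : (σ x, GTerm.subst σ H) ∈ (LTSact G).simN m) (T : GTerm G.sig) :
    (GTerm.subst σ T,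
      GTerm.subst (Function.update σ x (GTerm.var G.sig x)) (GTerm.unroll x H T)) ∈
      (LTSact G).simN m := by
  induction m generalizing T with
  | zero => trivial
  | succ m ih =>
    have key : ∀ T, T ≠ GTerm.var G.sig x → (GTerm.subst σ T,
        GTerm.subst (Function.update σ x (GTerm.var G.sig x)) (GTerm.unroll x H T)) ∈
        (LTSact G).simN (m + 1) := by
      intro T hT
      obtain ⟨n, rfl⟩ | ⟨A, c, rfl⟩ := GTerm.var_or_app T
      · have hn : n ≠ x := fun e => hT (by rw [e])
        rw [GTerm.unroll_var_of_ne _ hn, GTerm.subst_var, GTerm.subst_var,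
          Function.update_of_ne hn]
        exact LTS.simN_refl _ _
      · exact covers_map_app (GTerm.isHom_subst σ)
          ((GTerm.isHom_subst _).comp (GTerm.isHom_unroll x H))
          (ih (LTS.simN_succ_subset m hm)) A c
    by_cases hT : T = GTerm.var G.sig x
    · rw [hT, GTerm.unroll_var_self hne, GTerm.subst_var]
      exact LTS.simN_trans hm (key H hne)
    · exact key T hT

end Congruence

section Sizes

/-- The total number of nonterminal nodes in the right-hand sides of the rules. -/
def FOGrammar.rhsSize (G : FOGrammar) : ℕ := (G.rules.map fun r => r.rhs.size).sum

/-- The term `T` has at most `N` distinct subterms. -/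
def SizeLE {S : GrammarSig} (N : ℕ) (T : GTerm S) : Prop :=
  ∃ X : Finset (GTerm S), ChildClosed X ∧ T ∈ X ∧ X.card ≤ N

variable {G : FOGrammar}

theorem SizeLE.of_tr_app {N : ℕ} {a : Fin G.sig.actCount ⊕ ℕ} {A : Fin G.sig.ntCount}
    {c : Fin (G.sig.arity A) → GTerm G.sig} {T : GTerm G.sig} (h : SizeLE N (GTerm.app A c))
    (ht : (LTSact G).Tr a (GTerm.app A c) T) : SizeLE (N + G.rhsSize) T := by
  classical
  obtain ⟨X, hX, hmem, hcard⟩ := h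
  obtain ⟨r, hr, -, c', hc, rfl⟩ := LTSact_tr_app ht
  have hvars : ∀ n, r.rhs.VOccurs n → GRule.assign c' n ∈ X := by
    intro n hn
    rw [GRule.assign_of_lt _ (r.rhs_wf n hn)]
    exact hX _ hmem _ ⟨_, c', hc, _, rfl⟩
  refine ⟨X ∪ r.rhs.insts (GRule.assign c'), FTerm.childClosed_union_insts _ hX _ hvars,
    FTerm.inst_mem_union_insts _ _ hvars, ?_⟩
  calc _ ≤ X.card + (r.rhs.insts (GRule.assign c')).card := Finset.card_union_le _ _
    _ ≤ N + G.rhsSize := by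
        refine Nat.add_le_add hcard ((FTerm.card_insts_le _ _).trans ?_)
        exact List.single_le_sum (fun _ _ => Nat.zero_le _) _ (List.mem_map_of_mem hr)

theorem exists_var_simN (σ : ℕ → GTerm G.sig) {k N m : ℕ} {T U : GTerm G.sig}
    (hT : SizeLE N T) (hU : SizeLE N U) (hk : (T, U) ∉ (LTSact G).simN k) (hkm : k ≤ m)
    (hm : (GTerm.subst σ T, GTerm.subst σ U) ∈ (LTSact G).simN m) :
    ∃ x H, σ x ≠ GTerm.var G.sig x ∧ H ≠ GTerm.var G.sig x ∧ SizeLE (N + k * G.rhsSize) H ∧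
      (σ x, GTerm.subst σ H) ∈ (LTSact G).simN (m - k) := by
  induction k generalizing N m T U with
  | zero => exact (hk trivial).elim
  | succ k ih =>
    obtain ⟨m, rfl⟩ : ∃ m', m = m' + 1 := ⟨m - 1, by omega⟩
    have hle : N ≤ N + (k + 1) * G.rhsSize := Nat.le_add_right _ _
    have key : ∀ (n : ℕ) (V : GTerm G.sig), SizeLE N V →
        (GTerm.var G.sig n, V) ∉ (LTSact G).simN (k + 1) →
        (σ n, GTerm.subst σ V) ∈ (LTSact G).simN (m + 1) →
        σ n ≠ GTerm.var G.sig n →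
        ∃ x H, σ x ≠ GTerm.var G.sig x ∧ H ≠ GTerm.var G.sig x ∧
          SizeLE (N + (k + 1) * G.rhsSize) H ∧
          (σ x, GTerm.subst σ H) ∈ (LTSact G).simN (m + 1 - (k + 1)) := by
      intro n V hV hnot hsim hn
      refine ⟨n, V, hn, ?_, ?_, LTS.simN_antitone (Nat.sub_le _ _) hsim⟩
      · rintro rfl
        exact hnot (LTS.simN_refl _ _)
      · obtain ⟨X, h1, h2, h3⟩ := hV
        exact ⟨X, h1, h2, h3.trans hle⟩
    have key' : ∀ (n : ℕ) (V : GTerm G.sig), SizeLE N V →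
        (GTerm.var G.sig n, V) ∉ (LTSact G).simN (k + 1) →
        (σ n, GTerm.subst σ V) ∈ (LTSact G).simN (m + 1) →
        ∃ x H, σ x ≠ GTerm.var G.sig x ∧ H ≠ GTerm.var G.sig x ∧
          SizeLE (N + (k + 1) * G.rhsSize) H ∧
          (σ x, GTerm.subst σ H) ∈ (LTSact G).simN (m + 1 - (k + 1)) := by
      intro n V hV hnot hsim
      by_cases hn : σ n = GTerm.var G.sig n
      · have hVn : GTerm.subst σ V = GTerm.var G.sig n := eq_var_of_simN_succ (hn ▸ hsim)
        obtain ⟨p, rfl⟩ | ⟨A, c, rfl⟩ := GTerm.var_or_app V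
        · rw [GTerm.subst_var] at hVn hsim
          have hpn : p ≠ n := by
            rintro rfl
            exact hnot (LTS.simN_refl _ _)
          refine key p (GTerm.var G.sig n) ?_ (fun h => hnot (LTS.simN_symm h)) ?_ ?_
          · refine ⟨{GTerm.var G.sig n}, ?_, by simp, ?_⟩
            · intro T hT T' hT'
              rw [Finset.mem_singleton.1 hT] at hT'
              exact (not_childRel_var hT').elim
            · obtain ⟨X, -, h2, h3⟩ := hV
              rw [Finset.card_singleton]
              exact (Finset.card_pos.2 ⟨_, h2⟩).trans_le h3
          · rw [GTerm.subst_var]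
            exact LTS.simN_symm hsim
          · rw [hVn]
            exact fun h => hpn (GTerm.var_injective h).symm
        · rw [GTerm.subst_app] at hVn
          exact (GTerm.app_ne_var _ _ _ hVn).elim
      · exact key n V hV hnot hsim hn
    obtain ⟨n, rfl⟩ | ⟨A, c, rfl⟩ := GTerm.var_or_app T
    · rw [GTerm.subst_var] at hm
      exact key' n U hU hk hm
    obtain ⟨n, rfl⟩ | ⟨B, d, rfl⟩ := GTerm.var_or_app U
    · rw [GTerm.subst_var] at hm
      exact key' n _ hT (fun h => hk (LTS.simN_symm h)) (LTS.simN_symm hm)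
    have hσ := GTerm.isHom_subst σ
    have hsize : N + G.rhsSize + k * G.rhsSize = N + (k + 1) * G.rhsSize := by ring
    have hsub : m + 1 - (k + 1) = m - k := by omega
    rw [← hsize, hsub]
    obtain ⟨a, T', U', hT', hU', hnot, hsim⟩ : ∃ a T' U',
        (LTSact G).Tr a (GTerm.app A c) T' ∧ (LTSact G).Tr a (GTerm.app B d) U' ∧
        (T', U') ∉ (LTSact G).simN k ∧
        (GTerm.subst σ T', GTerm.subst σ U') ∈ (LTSact G).simN m := by
      by_contra hcon
      push Not at hcon
      refine hk ⟨fun a T' hT' => ?_, fun a U' hU' => ?_⟩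
      · obtain ⟨V, hV, hsim⟩ := hm.1 a _ (hσ.tr_map hT')
        obtain ⟨U', hU', rfl⟩ := hσ.exists_of_tr_map hV
        exact ⟨U', hU', by_contra fun h => hcon a T' U' hT' hU' h hsim⟩
      · obtain ⟨V, hV, hsim⟩ := hm.2 a _ (hσ.tr_map hU')
        obtain ⟨T', hT', rfl⟩ := hσ.exists_of_tr_map hV
        exact ⟨T', hT', by_contra fun h => hcon a T' U' hT' hU' h hsim⟩
    exact ih (hT.of_tr_app hT') (hU.of_tr_app hU') hnot (by omega) hsim

end Sizes

section Presentations

/-- The shape of a pair of terms with at most `N` subterms up to renaming of variables: the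
nonterminal nodes with their successors, the equalities between nodes, and the two roots. -/
abbrev PairShape (S : GrammarSig) (N : ℕ) : Type :=
  (Fin N → Option (Σ A : Fin S.ntCount, Fin (S.arity A) → Fin N)) ×
    (Fin N → Fin N → Prop) × Fin N × Fin N

/-- The nodes of a shape are interpreted by terms in accordance with the shape. -/
structure PairShape.Realizes {S : GrammarSig} {N : ℕ} (p : PairShape S N)
    (ι : Fin N → GTerm S) : Prop where
  app : ∀ v A ch, p.1 v = some ⟨A, ch⟩ → ι v = GTerm.app A fun i => ι (ch i)
  var : ∀ v, p.1 v = none → ∃ n, ι v = GTerm.var S n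
  eq_iff : ∀ u v, ι u = ι v ↔ p.2.1 u v

/-- The relation between terms generated by relating two interpretations of the same nodes. -/
inductive Corresp {S : GrammarSig} {N : ℕ} (ι ι' : Fin N → GTerm S) : GTerm S → GTerm S → Prop
  | node (v : Fin N) : Corresp ι ι' (ι v) (ι' v)
  | app (A : Fin S.ntCount) (c c' : Fin (S.arity A) → GTerm S) :
      (∀ i, Corresp ι ι' (c i) (c' i)) → Corresp ι ι' (GTerm.app A c) (GTerm.app A c')

theorem Corresp.symm {S : GrammarSig} {N : ℕ} {ι ι' : Fin N → GTerm S} {T T' : GTerm S}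
    (h : Corresp ι ι' T T') : Corresp ι' ι T' T := by
  induction h with
  | node v => exact .node v
  | app A c c' _ ih => exact .app A c' c ih

theorem Corresp.inst {S : GrammarSig} {N : ℕ} {ι ι' : Fin N → GTerm S} {s s' : ℕ → GTerm S}
    (E : FTerm S) (h : ∀ n, E.VOccurs n → Corresp ι ι' (s n) (s' n)) :
    Corresp ι ι' (E.inst s) (E.inst s') := by
  induction E with
  | var n => exact h n rfl
  | app A c ih => exact .app A _ _ fun i => ih i fun n hn => h n ⟨i, hn⟩

theorem PairShape.Realizes.corresp_cases {S : GrammarSig} {N : ℕ} {p : PairShape S N}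
    {ι ι' : Fin N → GTerm S} (hι : p.Realizes ι) (hι' : p.Realizes ι') {T T' : GTerm S}
    (h : Corresp ι ι' T T') :
    (∃ A c c', T = GTerm.app A c ∧ T' = GTerm.app A c' ∧ ∀ i, Corresp ι ι' (c i) (c' i)) ∨
      ∃ v n n', T = ι v ∧ T' = ι' v ∧ ι v = GTerm.var S n ∧ ι' v = GTerm.var S n' := by
  cases h with
  | node v =>
    cases hv : p.1 v with
    | none =>
      obtain ⟨n, hn⟩ := hι.var v hv
      obtain ⟨n', hn'⟩ := hι'.var v hv
      exact Or.inr ⟨v, n, n', rfl, rfl, hn, hn'⟩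
    | some q =>
      obtain ⟨A, ch⟩ := q
      exact Or.inl ⟨A, _, _, hι.app v A ch hv, hι'.app v A ch hv, fun i => .node (ch i)⟩
  | app A c c' hc => exact Or.inl ⟨A, c, c', rfl, rfl, hc⟩

variable {G : FOGrammar}

theorem PairShape.Realizes.tr_corresp {N : ℕ} {p : PairShape G.sig N}
    {ι ι' : Fin N → GTerm G.sig} (hι : p.Realizes ι) (hι' : p.Realizes ι')
    {a : Fin G.sig.actCount} {T T' U : GTerm G.sig} (h : Corresp ι ι' T T')
    (ht : (LTSact G).Tr (Sum.inl a) T U) :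
    ∃ U', (LTSact G).Tr (Sum.inl a) T' U' ∧ Corresp ι ι' U U' := by
  obtain ⟨r, hr, rfl, c, rfl, rfl⟩ := LTSact_tr_inl_iff.1 ht
  obtain ⟨A, d, d', hd, rfl, hdd⟩ | ⟨v, n, n', h1, -, h2, -⟩ := hι.corresp_cases hι' h
  · obtain ⟨rfl, hcd⟩ := GTerm.app_inj hd
    rw [eq_of_heq hcd]
    refine ⟨_, LTSact_tr_rule hr d', Corresp.inst _ fun n hn => ?_⟩
    rw [GRule.assign_of_lt _ (r.rhs_wf n hn), GRule.assign_of_lt _ (r.rhs_wf n hn)]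
    exact hdd _
  · exact (GTerm.app_ne_var _ _ _ (h1.trans h2)).elim

theorem PairShape.Realizes.corresp_unique {S : GrammarSig} {N : ℕ} {p : PairShape S N}
    {ι ι' : Fin N → GTerm S} (hι : p.Realizes ι) (hι' : p.Realizes ι') {n : ℕ}
    {T' U' : GTerm S} (hT : Corresp ι ι' (GTerm.var S n) T')
    (hU : Corresp ι ι' (GTerm.var S n) U') : ∃ n', T' = GTerm.var S n' ∧ U' = T' := by
  obtain ⟨A, d, d', hd, -⟩ | ⟨v, -, n', h1, rfl, -, h2⟩ := hι.corresp_cases hι' hT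
  · exact (GTerm.app_ne_var _ _ _ hd.symm).elim
  obtain ⟨A, d, d', hd, -⟩ | ⟨w, -, -, h3, rfl, -, -⟩ := hι.corresp_cases hι' hU
  · exact (GTerm.app_ne_var _ _ _ hd.symm).elim
  exact ⟨n', h2, (hι'.eq_iff _ _).2 ((hι.eq_iff _ _).1 (h3.symm.trans h1))⟩

theorem PairShape.Realizes.simN_corresp {N : ℕ} {p : PairShape G.sig N}
    {ι ι' : Fin N → GTerm G.sig} (hι : p.Realizes ι) (hι' : p.Realizes ι') {k : ℕ}
    {T T' U U' : GTerm G.sig} (hT : Corresp ι ι' T T') (hU : Corresp ι ι' U U')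
    (h : (T, U) ∈ (LTSact G).simN k) : (T', U') ∈ (LTSact G).simN k := by
  induction k generalizing T T' U U' with
  | zero => trivial
  | succ k ih =>
    have main : ∀ {T T' U U' : GTerm G.sig}, Corresp ι ι' T T' → Corresp ι ι' U U' →
        (T, U) ∈ (LTSact G).simN (k + 1) → ∀ a V', (LTSact G).Tr a T' V' →
        ∃ W', (LTSact G).Tr a U' W' ∧ (V', W') ∈ (LTSact G).simN k := by
      intro T T' U U' hT hU h a V' hV'
      cases a with
      | inl a =>
        obtain ⟨V, hV, hVV⟩ := hι'.tr_corresp hι hT.symm hV'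
        obtain ⟨W, hW, hVW⟩ := h.1 _ V hV
        obtain ⟨W', hW', hWW⟩ := hι.tr_corresp hι' hU hW
        exact ⟨W', hW', ih hVV.symm hWW hVW⟩
      | inr n =>
        obtain ⟨rfl, rfl⟩ := hV'
        obtain ⟨m, rfl, -⟩ := hι'.corresp_unique hι hT.symm hT.symm
        rw [eq_var_of_simN_succ h] at hU
        obtain ⟨n', -, rfl⟩ := hι.corresp_unique hι' hT hU
        exact ⟨_, ⟨rfl, rfl⟩, LTS.simN_refl _ _⟩
    refine ⟨main hT hU h, fun a W' hW' => ?_⟩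
    obtain ⟨V', hV', hsim⟩ := main hU hT (LTS.simN_symm h) a W' hW'
    exact ⟨V', hV', LTS.simN_symm hsim⟩

theorem exists_realizes {S : GrammarSig} {N : ℕ} {X : Finset (GTerm S)} (hX : ChildClosed X)
    (hcard : X.card ≤ N) {T U : GTerm S} (hT : T ∈ X) (hU : U ∈ X) :
    ∃ (p : PairShape S N) (ι : Fin N → GTerm S), p.Realizes ι ∧ ι p.2.2.1 = T ∧
      ι p.2.2.2 = U := by
  classical
  have : Nonempty X := ⟨⟨T, hT⟩⟩
  obtain ⟨f, hf⟩ : ∃ f : X → Fin N, Function.Injective f := by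
    have : Fintype.card X ≤ Fintype.card (Fin N) := by simpa using hcard
    obtain ⟨e⟩ := Function.Embedding.nonempty_of_card_le this
    exact ⟨e, e.injective⟩
  let ι : Fin N → GTerm S := fun v => (Function.invFun f v : X)
  have hι : ∀ v, ι v ∈ X := fun v => (Function.invFun f v).2
  have hsurj : ∀ V ∈ X, ∃ v, ι v = V := fun V hV =>
    ⟨f ⟨V, hV⟩, congrArg Subtype.val (Function.leftInverse_invFun hf ⟨V, hV⟩)⟩
  have hlab : ∀ v, ∃ q : Option (Σ A : Fin S.ntCount, Fin (S.arity A) → Fin N),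
      (∀ A ch, q = some ⟨A, ch⟩ → ι v = GTerm.app A fun i => ι (ch i)) ∧
      (q = none → ∃ n, ι v = GTerm.var S n) := by
    intro v
    obtain h | ⟨A, c, hc⟩ := GTerm.var_or_app (ι v)
    · exact ⟨none, by simp, fun _ => h⟩
    · have hch : ∀ i, ∃ w, ι w = c i := fun i =>
        hsurj _ (hX _ (hι v) _ (hc ▸ childRel_app.2 ⟨i, rfl⟩))
      choose ch hch using hch
      refine ⟨some ⟨A, ch⟩, fun B d h => ?_, by simp⟩
      obtain ⟨rfl, h⟩ := Sigma.mk.inj (Option.some.inj h)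
      rw [← eq_of_heq h, hc]
      simp only [hch]
  choose lab hlab using hlab
  obtain ⟨v, hv⟩ := hsurj T hT
  obtain ⟨w, hw⟩ := hsurj U hU
  exact ⟨(lab, fun u v => ι u = ι v, v, w), ι,
    ⟨fun u => (hlab u).1, fun u => (hlab u).2, fun _ _ => Iff.rfl⟩, hv, hw⟩

theorem exists_simN_bound (G : FOGrammar) (N : ℕ) :
    ∃ e : ℕ, ∀ (X : Finset (GTerm G.sig)) (T U : GTerm G.sig), ChildClosed X → X.card ≤ N →
      T ∈ X → U ∈ X → (∃ k, (T, U) ∉ (LTSact G).simN k) → (T, U) ∉ (LTSact G).simN e := by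
  have hshape : ∀ p : PairShape G.sig N, ∃ k, ∀ ι, p.Realizes ι →
      (∃ k', (ι p.2.2.1, ι p.2.2.2) ∉ (LTSact G).simN k') →
      (ι p.2.2.1, ι p.2.2.2) ∉ (LTSact G).simN k := by
    intro p
    by_cases h : ∃ ι, p.Realizes ι ∧ ∃ k, (ι p.2.2.1, ι p.2.2.2) ∉ (LTSact G).simN k
    · obtain ⟨ι, hι, k, hk⟩ := h
      exact ⟨k, fun ι' hι' _ hsim => hk (hι'.simN_corresp hι (.node _) (.node _) hsim)⟩
    · exact ⟨0, fun ι hι hk => (h ⟨ι, hι, hk⟩).elim⟩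
  choose k hk using hshape
  obtain ⟨e, he⟩ := (Set.finite_range k).bddAbove
  refine ⟨e, fun X T U hX hcard hT hU hne hsim => ?_⟩
  obtain ⟨p, ι, hp, rfl, rfl⟩ := exists_realizes hX hcard hT hU
  exact hk p ι hp hne (LTS.simN_antitone (he ⟨p, rfl⟩) hsim)

end Presentations

/-- Either the eq-level of an instance `(Tσ, Uσ)` is small or some variable `x` in the support
of `σ` is equivalent, up to almost that level, to an instance of a small term other than `x`. -/
theorem exists_small_or_var_simN (G : FOGrammar) (N : ℕ) :
    ∃ e : ℕ, ∀ (X : Finset (GTerm G.sig)) (T U : GTerm G.sig) (σ : ℕ → GTerm G.sig) (m : ℕ),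
      ChildClosed X → X.card ≤ N → T ∈ X → U ∈ X →
      (LTSact G).eqlevel (GTerm.subst σ T) (GTerm.subst σ U) = m →
      m < e ∨ ∃ x H, σ x ≠ GTerm.var G.sig x ∧ H ≠ GTerm.var G.sig x ∧
        SizeLE (N + e * G.rhsSize) H ∧ (σ x, GTerm.subst σ H) ∈ (LTSact G).simN (m - e) := by
  obtain ⟨e, he⟩ := exists_simN_bound G N
  refine ⟨e, fun X T U σ m hX hcard hT hU hlev => ?_⟩
  obtain ⟨hm, hm'⟩ := LTS.eqlevel_eq_coe_iff.1 hlev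
  refine (lt_or_ge m e).imp_right fun hem => ?_
  have hne := he X T U hX hcard hT hU ⟨m + 1, fun h => hm' (simN_subst σ h)⟩
  exact exists_var_simN σ ⟨X, hX, hT, hcard⟩ ⟨X, hX, hU, hcard⟩ hne hem hm

theorem eqlevel_unroll {G : FOGrammar} {σ : ℕ → GTerm G.sig} {x m : ℕ} {H : GTerm G.sig}
    (hne : H ≠ GTerm.var G.sig x)
    (hx : (σ x, GTerm.subst σ H) ∈ (LTSact G).simN (m + 1)) {T U : GTerm G.sig}
    (h : (LTSact G).eqlevel (GTerm.subst σ T) (GTerm.subst σ U) = m) :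
    (LTSact G).eqlevel
      (GTerm.subst (Function.update σ x (GTerm.var G.sig x)) (GTerm.unroll x H T))
      (GTerm.subst (Function.update σ x (GTerm.var G.sig x)) (GTerm.unroll x H U)) = m := by
  obtain ⟨h1, h2⟩ := LTS.eqlevel_eq_coe_iff.1 h
  have hT := simN_unroll hne hx T
  have hU := simN_unroll hne hx U
  refine LTS.eqlevel_eq_coe_iff.2 ⟨?_, fun h' => h2 ?_⟩
  · exact LTS.simN_trans (LTS.simN_symm (LTS.simN_succ_subset m hT))
      (LTS.simN_trans h1 (LTS.simN_succ_subset m hU))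
  · exact LTS.simN_trans hT (LTS.simN_trans h' (LTS.simN_symm hU))

theorem exists_length_bound (G : FOGrammar) (n : ℕ) (g : ℕ → ℕ) :
    ∃ ℓ : ℕ, ∀ (L : ℕ) (E F : ℕ → GTerm G.sig) (σ : ℕ → GTerm G.sig) (lev : ℕ → ℕ),
      FinSupp σ → {x | σ x ≠ GTerm.var G.sig x}.ncard ≤ n →
      (∀ j < L, ∃ X : Finset (GTerm G.sig), ChildClosed X ∧ E j ∈ X ∧ F j ∈ X ∧
        X.card ≤ g j) →
      (∀ j < L, (LTSact G).eqlevel (GTerm.subst σ (E j)) (GTerm.subst σ (F j)) = lev j) →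
      (∀ j, j + 1 < L → lev (j + 1) < lev j) → L ≤ ℓ := by
  classical
  have hlevels : ∀ (lev : ℕ → ℕ) (L : ℕ), (∀ j, j + 1 < L → lev (j + 1) < lev j) →
      ∀ j < L, lev j + j ≤ lev 0 := by
    intro lev L hdec j
    induction j with
    | zero => simp
    | succ j ih =>
      intro hj
      have h1 := hdec j hj
      have h2 := ih (by omega)
      omega
  induction n generalizing g with
  | zero =>
    obtain ⟨e, he⟩ := exists_small_or_var_simN G (g 0)
    refine ⟨e, fun L E F σ lev hfin hcard hX hlev hdec => ?_⟩
    rcases Nat.eq_zero_or_pos L with rfl | hL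
    · exact Nat.zero_le _
    obtain ⟨X, hXc, hE, hF, hXcard⟩ := hX 0 hL
    obtain h | ⟨x, -, hx, -⟩ := he X _ _ σ _ hXc hXcard hE hF (hlev 0 hL)
    · have := hlevels lev L hdec (L - 1) (by omega)
      omega
    · have hempty := (Set.ncard_eq_zero hfin).1 (Nat.le_zero.1 hcard)
      exact (Set.eq_empty_iff_forall_notMem.1 hempty x hx).elim
  | succ n ih =>
    obtain ⟨e, he⟩ := exists_small_or_var_simN G (g 0)
    obtain ⟨ℓ, hℓ⟩ := ih fun j => g (j + (e + 1)) + (g 0 + e * G.rhsSize)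
    refine ⟨ℓ + (e + 1), fun L E F σ lev hfin hcard hX hlev hdec => ?_⟩
    rcases Nat.eq_zero_or_pos L with rfl | hL
    · exact Nat.zero_le _
    obtain ⟨X, hXc, hE, hF, hXcard⟩ := hX 0 hL
    obtain h | ⟨x, H, hx, hH, ⟨Y, hYc, hHY, hYcard⟩, hsim⟩ :=
      he X _ _ σ _ hXc hXcard hE hF (hlev 0 hL)
    · have := hlevels lev L hdec (L - 1) (by omega)
      omega
    have hsupp : {y | Function.update σ x (GTerm.var G.sig x) y ≠ GTerm.var G.sig y} =
        {y | σ y ≠ GTerm.var G.sig y} \ {x} := by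
      ext y
      by_cases hy : y = x
      · subst hy
        simp
      · simp [hy]
    refine Nat.sub_le_iff_le_add.1 (hℓ (L - (e + 1)) (fun j => GTerm.unroll x H (E (j + (e + 1))))
      (fun j => GTerm.unroll x H (F (j + (e + 1))))
      (Function.update σ x (GTerm.var G.sig x)) (fun j => lev (j + (e + 1))) ?_ ?_ ?_ ?_ ?_)
    · unfold FinSupp
      rw [hsupp]
      exact hfin.subset Set.sdiff_subset
    · rw [hsupp, Set.ncard_sdiff_singleton_of_mem (show x ∈ {y | σ y ≠ GTerm.var G.sig y} from hx)]
      omega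
    · intro j hj
      obtain ⟨Z, hZc, hEZ, hFZ, hZcard⟩ := hX (j + (e + 1)) (by omega)
      refine ⟨(Z ∪ Y).image (GTerm.unroll x H),
        (hZc.union hYc).image_unroll (Finset.mem_union_right _ hHY) hH,
        Finset.mem_image_of_mem _ (Finset.mem_union_left _ hEZ),
        Finset.mem_image_of_mem _ (Finset.mem_union_left _ hFZ), ?_⟩
      exact Finset.card_image_le.trans
        ((Finset.card_union_le _ _).trans (Nat.add_le_add hZcard hYcard))
    · intro j hj
      have := hlevels lev L hdec (j + (e + 1)) (by omega)
      exact eqlevel_unroll hH (LTS.simN_antitone (by omega) hsim) (hlev _ (by omega))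
    · intro j hj
      have := hdec (j + (e + 1)) (by omega)
      rwa [show j + (e + 1) + 1 = j + 1 + (e + 1) by omega] at this


/-- for every `n ∈ ℕ` and every nondecreasing `g : ℕ_+ → ℕ_+` (here
`g : ℕ → ℕ`, positive and monotone, with `g (j+1)` playing the role of `g(j+1)` for the
1-based index `j+1`), there is `ℓ` bounding the length of every eqlevel-decreasing
`(n,g)`-sequence: a sequence of pairs `(E_jσ, F_jσ)` (`j = 0, …, L−1`, all terms
regular) for a substitution `σ` with `|supp(σ)| ≤ n` and `pressize(E_j,F_j) ≤ g(j+1)`,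
whose eq-levels satisfy `ω > eqlevel(E_0σ,F_0σ) > eqlevel(E_1σ,F_1σ) > ⋯`. -/
theorem eqlevel_decreasing_ng_sequence_bounded (G : FOGrammar) (n : ℕ) (g : ℕ → ℕ)
    (hgpos : ∀ j, 0 < g j) (hgmono : Monotone g) :
    ∃ ℓ : ℕ, ∀ (L : ℕ) (E F : ℕ → GTerm G.sig) (σ : ℕ → GTerm G.sig),
      FinSupp σ → {x | σ x ≠ GTerm.var G.sig x}.ncard ≤ n →
      (∀ x, RegularT G.sig (σ x)) →
      (∀ j < L, RegularT G.sig (E j) ∧ RegularT G.sig (F j) ∧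
        pressize G.sig (E j) + pressize G.sig (F j) ≤ g (j + 1)) →
      (0 < L →
        (LTSact G).eqlevel (GTerm.subst σ (E 0)) (GTerm.subst σ (F 0)) < ⊤) →
      (∀ j, j + 1 < L →
        (LTSact G).eqlevel (GTerm.subst σ (E (j + 1))) (GTerm.subst σ (F (j + 1))) <
          (LTSact G).eqlevel (GTerm.subst σ (E j)) (GTerm.subst σ (F j))) →
      L ≤ ℓ := by
  classical
  obtain ⟨ℓ, hℓ⟩ := exists_length_bound G n fun j => g (j + 1)
  refine ⟨ℓ, fun L E F σ hfin hcard _ hsize htop hdec => ?_⟩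
  have hfinite : ∀ j < L,
      (LTSact G).eqlevel (GTerm.subst σ (E j)) (GTerm.subst σ (F j)) < ⊤ := by
    intro j
    cases j with
    | zero => exact htop
    | succ j => exact fun hj => (hdec j hj).trans_le le_top
  have hlev : ∀ j < L, (LTSact G).eqlevel (GTerm.subst σ (E j)) (GTerm.subst σ (F j)) =
      ((LTSact G).eqlevel (GTerm.subst σ (E j)) (GTerm.subst σ (F j))).toNat :=
    fun j hj => (ENat.natCast_toNat (hfinite j hj).ne).symm
  refine hℓ L E F σ (fun j =>
    ((LTSact G).eqlevel (GTerm.subst σ (E j)) (GTerm.subst σ (F j))).toNat) hfin hcard ?_ hlev ?_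
  · intro j hj
    obtain ⟨hE, hF, hEF⟩ := hsize j hj
    obtain ⟨X, hX, hEX, hXcard⟩ := exists_childClosed_of_regularT hE
    obtain ⟨Y, hY, hFY, hYcard⟩ := exists_childClosed_of_regularT hF
    refine ⟨X ∪ Y, hX.union hY, Finset.mem_union_left _ hEX, Finset.mem_union_right _ hFY, ?_⟩
    exact (Finset.card_union_le _ _).trans (by rwa [hXcard, hYcard])
  · intro j hj
    have h := hdec j hj
    rw [hlev j (by omega), hlev (j + 1) hj] at h
    exact_mod_cast h
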